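/- Let d ≥ 1, let μ ∈ P_1(ℝ^d) be centered and not supported on an affine hyperplane, let u : ℝ^d → ℝ ∪ {+∞} be convex, lower semicontinuous and proper, let c > 0, and suppose the measure ρ with Lebesgue density x ↦ c·e^{−u(x)} is a probability measure minimizing E(·) + T(·,μ) over P_1(ℝ^d). Then H^{d−1}({x ∈ frontier({u < +∞}) : u(x) < +∞}) = 0, where H^{d−1} denotes (d−1)-dimensional Hausdorff measure; i.e., the density c·e^{−u} vanishes H^{d−1}-a.e. on the topological boundary of {u < +∞}. -/

import Mathlib

open MeasureTheory Real Filter Topology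
open scoped ENNReal RealInnerProductSpace

noncomputable section

/-- `d`-dimensional Euclidean space. -/
abbrev Ed (d : ℕ) := EuclideanSpace ℝ (Fin d)

open Classical in
/-- The entropy `E(ρ) = ∫ f ln f dx` (extended-real-valued, computed as positive part minus
negative part of the integral of `f ln f`, where `f` is the density), and `+∞` if `ρ` is not
absolutely continuous w.r.t. Lebesgue measure. -/
def entropy {d : ℕ} (ρ : Measure (Ed d)) : EReal :=
  if ρ ≪ (volume : Measure (Ed d)) then
    ((∫⁻ x, ENNReal.ofReal ((ρ.rnDeriv volume x).toReal *
        Real.log (ρ.rnDeriv volume x).toReal) : ℝ≥0∞) : EReal)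
      - ((∫⁻ x, ENNReal.ofReal (-((ρ.rnDeriv volume x).toReal *
        Real.log (ρ.rnDeriv volume x).toReal)) : ℝ≥0∞) : EReal)
  else ⊤

/-- The (extended-real-valued) integral `∫ ⟨x,y⟩ dγ(x,y)`: positive part minus negative part. -/
def pairInt {d : ℕ} (γ : Measure (Ed d × Ed d)) : EReal :=
  ((∫⁻ p, ENNReal.ofReal (⟪p.1, p.2⟫ : ℝ) ∂γ : ℝ≥0∞) : EReal)
    - ((∫⁻ p, ENNReal.ofReal (-(⟪p.1, p.2⟫ : ℝ)) ∂γ : ℝ≥0∞) : EReal)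

/-- Transport plans: probability measures on the product with marginals `ρ` and `μ`. -/
def Couplings {d : ℕ} (ρ μ : Measure (Ed d)) : Set (Measure (Ed d × Ed d)) :=
  {γ | IsProbabilityMeasure γ ∧ γ.fst = ρ ∧ γ.snd = μ}

/-- The maximal correlation functional `T(ρ,μ) = sup { ∫⟨x,y⟩ dγ : γ ∈ Π(ρ,μ) }`. -/
def maxCorr {d : ℕ} (ρ μ : Measure (Ed d)) : EReal :=
  ⨆ γ ∈ Couplings ρ μ, pairInt γ

/-- `ρ` has finite first moment. -/
def FirstMoment {d : ℕ} (ρ : Measure (Ed d)) : Prop := Integrable (fun x => ‖x‖) ρ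

/-- `ρ` is centered: its barycenter is `0`. -/
def Centered {d : ℕ} (ρ : Measure (Ed d)) : Prop := (∫ x, x ∂ρ) = 0

/-- Weak convergence of measures: convergence of integrals of bounded continuous functions. -/
def WeakConv {d : ℕ} (ρs : ℕ → Measure (Ed d)) (ρ : Measure (Ed d)) : Prop :=
  ∀ f : BoundedContinuousFunction (Ed d) ℝ,
    Tendsto (fun n => ∫ x, f x ∂(ρs n)) atTop (𝓝 (∫ x, f x ∂ρ))

/-- Convexity for extended-real-valued functions on `Ed d`. -/
def EConvexOn {d : ℕ} (u : Ed d → EReal) : Prop :=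
  ∀ x y : Ed d, ∀ a b : ℝ, 0 ≤ a → 0 ≤ b → a + b = 1 →
    u (a • x + b • y) ≤ (a : EReal) * u x + (b : EReal) * u y

/-- `e^{-t}` for `t ∈ ℝ ∪ {+∞}`, with `e^{-∞} = 0`. -/
def expNegE (t : EReal) : ℝ := if t = ⊤ then 0 else Real.exp (-t.toReal)

/-- The Legendre transform `u*(y) = sup_x (⟨x,y⟩ - u(x))`. -/
def legendre {d : ℕ} (u : Ed d → EReal) (y : Ed d) : EReal :=
  ⨆ x : Ed d, (((⟪x, y⟫ : ℝ) : EReal) - u x)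

/-- The essential continuity of a convex l.s.c. function `u : ℝ^d → ℝ ∪ {+∞}`:
`u` tends to `+∞` at `H^{d-1}`-a.e. point of the boundary of its domain. -/
def EssentiallyContinuous {d : ℕ} (u : Ed d → EReal) : Prop :=
  μH[(d : ℝ) - 1] {x : Ed d | x ∈ frontier {y | u y < ⊤} ∧ u x < ⊤} = 0

/-- A null version of Eilenberg's inequality. -/
theorem ae_hausdorffMeasure_inter_fiber_eq_zero {X : Type*} [MetricSpace X] [MeasurableSpace X]
    [BorelSpace X] {s : ℝ} (hs : 0 ≤ s) {g : X → ℝ} {L : NNReal} (hg : LipschitzWith L g)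
    {B : Set X} (hB : μH[s + 1] B = 0) : ∀ᵐ t : ℝ, μH[s] (B ∩ g ⁻¹' {t}) = 0 := by
  have hcover : ∀ n : ℕ, ∃ U : ℕ → Set X, B ⊆ ⋃ j, U j ∧
      (∀ j, Metric.ediam (U j) ≤ (2⁻¹ : ℝ≥0∞) ^ n) ∧
      ∑' j, Metric.ediam (U j) ^ (s + 1) ≤ (2⁻¹ : ℝ≥0∞) ^ n := by
    intro n
    have hpos : (0 : ℝ≥0∞) < 2⁻¹ ^ n := ENNReal.pow_pos (by simp) n
    rw [Measure.hausdorffMeasure_apply] at hB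
    have h1 := hB.le
    rw [iSup₂_le_iff] at h1
    have h2 := (h1 _ hpos).trans_lt hpos
    simp only [iInf_lt_iff] at h2
    obtain ⟨U, hU, hd, hsum⟩ := h2
    refine ⟨U, hU, hd, le_trans (ENNReal.tsum_le_tsum fun j => ?_) hsum.le⟩
    rcases (U j).eq_empty_or_nonempty with h | h
    · simp [h, ENNReal.zero_rpow_of_pos (by linarith : 0 < s + 1)]
    · exact le_iSup (fun _ : (U j).Nonempty => Metric.ediam (U j) ^ (s + 1)) h
  choose U hU hd hsum using hcover
  let h : ℕ → ℕ → ℝ → ℝ≥0∞ := fun n j =>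
    (closure (g '' U n j)).indicator fun _ => Metric.ediam (U n j) ^ s
  have hmeas : ∀ n j, Measurable (h n j) := fun n j =>
    measurable_const.indicator isClosed_closure.measurableSet
  have hint : ∀ n j, ∫⁻ t, h n j t ≤ L * Metric.ediam (U n j) ^ (s + 1) := by
    intro n j
    rw [lintegral_indicator_const isClosed_closure.measurableSet]
    calc _ ≤ Metric.ediam (U n j) ^ s * (L * Metric.ediam (U n j)) := by
          gcongr
          refine (Real.volume_le_diam _).trans ?_
          rw [Metric.ediam_closure]
          exact hg.ediam_image_le _
      _ = _ := by
          rw [ENNReal.rpow_add_of_nonneg _ _ hs zero_le_one, ENNReal.rpow_one]; ring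
  have htot : ∫⁻ t, ∑' n, ∑' j, h n j t ≠ ∞ := by
    rw [lintegral_tsum fun n => (Measurable.tsum (hmeas n)).aemeasurable]
    simp_rw [fun n => lintegral_tsum fun j => (hmeas n j).aemeasurable (μ := volume)]
    refine ne_of_lt (lt_of_le_of_lt (b := ∑' n : ℕ, (L : ℝ≥0∞) * 2⁻¹ ^ n) ?_ ?_)
    · refine ENNReal.tsum_le_tsum fun n => (ENNReal.tsum_le_tsum (hint n)).trans ?_
      rw [ENNReal.tsum_mul_left]
      gcongr
      exact hsum n
    · rw [ENNReal.tsum_mul_left, ENNReal.tsum_geometric]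
      exact ENNReal.mul_lt_top ENNReal.coe_lt_top (by simp)
  have hmeas' : Measurable fun t => ∑' n, ∑' j, h n j t :=
    Measurable.tsum fun n => Measurable.tsum (hmeas n)
  filter_upwards [ae_lt_top hmeas' htot] with t ht
  have hlim : Tendsto (fun n => ∑' j, h n j t) atTop (𝓝 0) :=
    ENNReal.tendsto_atTop_zero_of_tsum_ne_top ht.ne
  have hle := Measure.hausdorffMeasure_le_liminf_tsum s (B ∩ g ⁻¹' {t}) (l := atTop)
    (ι := fun n => {j // t ∈ closure (g '' U n j)}) (fun n : ℕ => (2⁻¹ : ℝ≥0∞) ^ n)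
    (ENNReal.tendsto_pow_atTop_nhds_zero_of_lt_one (by simp)) (fun n j => U n j)
    (Eventually.of_forall fun n j => hd n j) (Eventually.of_forall fun n x hx => by
      obtain ⟨j, hj⟩ := Set.mem_iUnion.1 (hU n hx.1)
      have hxt : g x = t := hx.2
      exact Set.mem_iUnion.2 ⟨⟨j, subset_closure ⟨x, hj, hxt⟩⟩, hj⟩)
  refine le_antisymm (hle.trans ?_) zero_le
  rw [← hlim.liminf_eq]
  refine le_of_eq (congrArg (fun f => liminf f atTop) (funext fun n => ?_))
  exact tsum_subtype {j | t ∈ closure (g '' U n j)} fun j => Metric.ediam (U n j) ^ s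

open scoped Pointwise in
/-- If the cone from an interior point `p` of a convex set over a part `A` of its boundary is
Lebesgue-null, then `A` is null for the Hausdorff measure of codimension one. -/
theorem Convex.hausdorffMeasure_eq_zero_of_cone_null {d : ℕ} (hd : 1 ≤ d) {s : Set (Ed d)}
    (hs : Convex ℝ s) {p : Ed d} (hp : p ∈ interior s) {A : Set (Ed d)} (hA : A ⊆ frontier s)
    (hK : volume ((fun q : ℝ × Ed d => p + q.1 • (q.2 - p)) '' (Set.Icc 0 1 ×ˢ A)) = 0) :
    μH[(d : ℝ) - 1] A = 0 := by
  have hd1 : (0 : ℝ) ≤ (d : ℝ) - 1 := by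
    have : (1 : ℝ) ≤ d := by exact_mod_cast hd
    linarith
  have htr : ∀ B : Set (Ed d), μH[(d : ℝ) - 1] ((-p) +ᵥ B) = μH[(d : ℝ) - 1] B := fun B =>
    (isometry_vadd (Ed d) (-p)).hausdorffMeasure_image (.inl hd1) B
  have hs' : Convex ℝ ((-p) +ᵥ s) := hs.vadd _
  have hs0 : (-p) +ᵥ s ∈ 𝓝 (0 : Ed d) := by
    rw [mem_interior_iff_mem_nhds] at hp
    have := vadd_mem_nhds_vadd_iff (-p) |>.2 hp
    simpa using this
  have hfr : ∀ a ∈ A, gauge ((-p) +ᵥ s) (a - p) = 1 := by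
    intro a ha
    rw [gauge_eq_one_iff_mem_frontier hs' hs0]
    have : frontier ((-p) +ᵥ s) = (-p) +ᵥ frontier s :=
      ((Homeomorph.vadd (-p)).image_frontier s).symm
    rw [this]
    exact ⟨a, hA ha, by simp [sub_eq_neg_add]⟩
  obtain ⟨L, hL⟩ := hs'.lipschitz_gauge hs0
  set K : Set (Ed d) := (fun q : ℝ × Ed d => p + q.1 • (q.2 - p)) '' (Set.Icc 0 1 ×ˢ A) with hKdef
  have hK' : μH[(d : ℝ) - 1 + 1] ((-p) +ᵥ K) = 0 := by
    rw [sub_add_cancel]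
    have hv : volume ((-p) +ᵥ K) = 0 := by rw [measure_vadd]; exact hK
    have : (d : ℝ) = Module.finrank ℝ (Ed d) := by simp
    rw [this]
    exact Measure.absolutelyContinuous_isAddHaarMeasure _ volume hv
  have hae := ae_hausdorffMeasure_inter_fiber_eq_zero hd1 hL hK'
  obtain ⟨t, ht, ht0⟩ : ∃ t ∈ Set.Ioo (0 : ℝ) 1,
      μH[(d : ℝ) - 1] (((-p) +ᵥ K) ∩ gauge ((-p) +ᵥ s) ⁻¹' {t}) = 0 := by
    by_contra! hcon
    have : volume (Set.Ioo (0 : ℝ) 1) = 0 :=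
      measure_mono_null (fun t ht => hcon t ht) (ae_iff.1 hae)
    simp at this
  have hsub : t • ((-p) +ᵥ A) ⊆ ((-p) +ᵥ K) ∩ gauge ((-p) +ᵥ s) ⁻¹' {t} := by
    rintro _ ⟨_, ⟨a, ha, rfl⟩, rfl⟩
    have he : t • (-p +ᵥ a) = t • (a - p) := by simp [sub_eq_neg_add]
    refine ⟨⟨p + t • (a - p), ⟨(t, a), ⟨⟨ht.1.le, ht.2.le⟩, ha⟩, rfl⟩, ?_⟩, ?_⟩
    · simp [sub_eq_neg_add]
    · simp only [he, Set.mem_preimage, Set.mem_singleton_iff]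
      rw [gauge_smul_of_nonneg ht.1.le, hfr a ha, smul_eq_mul, mul_one]
  have h0 := measure_mono_null hsub ht0
  rw [Measure.hausdorffMeasure_smul₀ hd1 ht.1.ne'] at h0
  rw [← htr A]
  have hne : ‖t‖₊ ^ ((d : ℝ) - 1) ≠ 0 := by
    rw [Ne, NNReal.rpow_eq_zero_iff]; simp [ht.1.ne']
  simpa [ENNReal.smul_def, hne] using h0

/-- The entropy in terms of a given density. -/
theorem entropy_withDensity {d : ℕ} {f : Ed d → ℝ} (hf : Measurable f) (hf0 : ∀ x, 0 ≤ f x) :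
    entropy (volume.withDensity fun x => ENNReal.ofReal (f x)) =
      ((∫⁻ x, ENNReal.ofReal (f x * log (f x)) : ℝ≥0∞) : EReal) -
        ((∫⁻ x, ENNReal.ofReal (-(f x * log (f x))) : ℝ≥0∞) : EReal) := by
  have hrn : ((volume.withDensity fun x => ENNReal.ofReal (f x)).rnDeriv volume) =ᵐ[volume]
      fun x => ENNReal.ofReal (f x) := Measure.rnDeriv_withDensity _ hf.ennreal_ofReal
  have h1 : ∀ F : ℝ → ℝ≥0∞, (∫⁻ x,
      F ((volume.withDensity fun x => ENNReal.ofReal (f x)).rnDeriv volume x).toReal) =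
      ∫⁻ x, F (f x) := fun F => lintegral_congr_ae <| by
    filter_upwards [hrn] with x hx
    rw [hx, ENNReal.toReal_ofReal (hf0 x)]
  rw [entropy, if_pos (withDensity_absolutelyContinuous _ _),
    h1 fun t => ENNReal.ofReal (t * log t), h1 fun t => ENNReal.ofReal (-(t * log t))]

theorem integrable_withDensity_ofReal {d : ℕ} {f : Ed d → ℝ} (hf : Measurable f)
    (hf0 : ∀ x, 0 ≤ f x) {g : Ed d → ℝ} :
    Integrable g (volume.withDensity fun x => ENNReal.ofReal (f x)) ↔
      Integrable fun x => f x * g x := by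
  rw [integrable_withDensity_iff_integrable_smul' hf.ennreal_ofReal (by simp)]
  simp [ENNReal.toReal_ofReal, hf0]

theorem integral_withDensity_ofReal {d : ℕ} {f : Ed d → ℝ} (hf : Measurable f)
    (hf0 : ∀ x, 0 ≤ f x) (g : Ed d → ℝ) :
    ∫ x, g x ∂(volume.withDensity fun x => ENNReal.ofReal (f x)) = ∫ x, f x * g x := by
  rw [integral_withDensity_eq_integral_toReal_smul hf.ennreal_ofReal (by simp)]
  simp [ENNReal.toReal_ofReal, hf0]

/-- The entropy of a measure is the mean of the logarithm of its density. -/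
theorem entropy_eq_integral_log {d : ℕ} {f : Ed d → ℝ} (hf : Measurable f) (hf0 : ∀ x, 0 ≤ f x)
    {ρ : Measure (Ed d)} (hρ : ρ = volume.withDensity fun x => ENNReal.ofReal (f x))
    (hint : Integrable (fun x => log (f x)) ρ) :
    entropy ρ = ((∫ x, log (f x) ∂ρ : ℝ) : EReal) := by
  subst hρ
  have hint' := (integrable_withDensity_ofReal hf hf0).1 hint
  rw [integral_withDensity_ofReal hf hf0, entropy_withDensity hf hf0,
    integral_eq_lintegral_pos_part_sub_lintegral_neg_part hint', EReal.coe_sub,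
    EReal.coe_ennreal_toReal hint'.lintegral_lt_top.ne,
    EReal.coe_ennreal_toReal (show Integrable (fun x => -(f x * log (f x))) volume from
      hint'.neg).lintegral_lt_top.ne]

theorem neg_mul_log_le {t q : ℝ} (ht : 0 ≤ t) (hq : 0 < q) : -(t * log t) ≤ t * (-log q) + q := by
  rcases ht.eq_or_lt with rfl | ht
  · simpa using hq.le
  have h := log_le_sub_one_of_pos (div_pos hq ht)
  rw [log_div hq.ne' ht.ne'] at h
  have h2 := mul_le_mul_of_nonneg_left h ht.le
  have h3 : t * (q / t - 1) = q - t := by field_simp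
  nlinarith

/-- The negative part of the entropy of a density with finite first moment is finite. -/
theorem lintegral_neg_mul_log_lt_top {d : ℕ} {f : Ed d → ℝ} (hf : Measurable f)
    (hf0 : ∀ x, 0 ≤ f x)
    (hf1 : FirstMoment (volume.withDensity fun x => ENNReal.ofReal (f x))) :
    ∫⁻ x, ENNReal.ofReal (-(f x * log (f x))) < ∞ := by
  have h1 : Integrable fun x => f x * ‖x‖ := (integrable_withDensity_ofReal hf hf0).1 hf1
  have h2 : Integrable fun x : Ed d => (1 + ‖x‖) ^ (-((d : ℝ) + 1)) :=
    integrable_one_add_norm (by simp)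
  refine lt_of_le_of_lt (lintegral_mono fun x => ENNReal.ofReal_le_ofReal ?_)
    ((h1.mul_const ((d : ℝ) + 1)).add h2).lintegral_lt_top
  have hx : 0 ≤ ‖x‖ := norm_nonneg x
  refine (neg_mul_log_le (hf0 x)
    (rpow_pos_of_pos (by linarith : 0 < 1 + ‖x‖) (-((d : ℝ) + 1)))).trans ?_
  rw [log_rpow (by linarith)]
  simp only [Pi.add_apply]
  have h3 : log (1 + ‖x‖) ≤ ‖x‖ := by
    have := log_le_sub_one_of_pos (by linarith : 0 < 1 + ‖x‖); linarith
  have h4 := mul_le_mul_of_nonneg_left h3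
    (mul_nonneg (hf0 x) (by positivity : (0 : ℝ) ≤ (d : ℝ) + 1))
  nlinarith

/-- Finiteness of the entropy forces integrability of the logarithm of the density. -/
theorem integrable_log_of_entropy_ne_top {d : ℕ} {f : Ed d → ℝ} (hf : Measurable f)
    (hf0 : ∀ x, 0 ≤ f x) {ρ : Measure (Ed d)}
    (hρ : ρ = volume.withDensity fun x => ENNReal.ofReal (f x)) (hf1 : FirstMoment ρ)
    (hE : entropy ρ ≠ ⊤) : Integrable (fun x => log (f x)) ρ := by
  subst hρ
  have hneg := lintegral_neg_mul_log_lt_top hf hf0 hf1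
  rw [integrable_withDensity_ofReal hf hf0]
  have hm : Measurable fun x => f x * log (f x) := hf.mul hf.log
  rw [entropy_withDensity hf hf0] at hE
  have hpos : ∫⁻ x, ENNReal.ofReal (f x * log (f x)) < ∞ := by
    rw [lt_top_iff_ne_top]
    intro h
    rw [h] at hE
    refine hE ?_
    lift (∫⁻ x, ENNReal.ofReal (-(f x * log (f x)))) to NNReal using hneg.ne with r
    exact EReal.top_sub_coe _
  refine ⟨hm.aestronglyMeasurable, ?_⟩
  refine lt_of_le_of_lt (lintegral_mono fun x => ?_)
    (lintegral_add_left hm.ennreal_ofReal _ ▸ ENNReal.add_lt_top.2 ⟨hpos, hneg⟩)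
  rw [enorm_eq_ofReal_abs]
  rcases abs_cases (f x * log (f x)) with h | h <;> rw [h.1]
  · exact le_self_add
  · exact le_add_self

theorem coe_sub_coe_le_add_two_mul {P N P' N' : ℝ≥0∞} {C : ℝ} (hC : 0 ≤ C)
    (hP : P ≤ P' + ENNReal.ofReal C) (hN : N' ≤ N + ENNReal.ofReal C) :
    (P : EReal) - N ≤ (P' : EReal) - N' + ((2 * C : ℝ) : EReal) := by
  rcases eq_or_ne N ∞ with rfl | hNt
  · simp
  have hN't : N' ≠ ∞ := ne_top_of_le_ne_top (by finiteness) hN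
  rcases eq_or_ne P' ∞ with rfl | hP't
  · lift N' to NNReal using hN't
    have : ((∞ : ℝ≥0∞) : EReal) - ((N' : ℝ≥0∞) : EReal) = ⊤ := EReal.top_sub_coe _
    rw [this, EReal.top_add_coe]
    exact le_top
  have hPt : P ≠ ∞ := ne_top_of_le_ne_top (by finiteness) hP
  have e1 := ENNReal.toReal_mono (by finiteness) hP
  have e2 := ENNReal.toReal_mono (by finiteness) hN
  rw [ENNReal.toReal_add hP't (by finiteness), ENNReal.toReal_ofReal hC] at e1
  rw [ENNReal.toReal_add hNt (by finiteness), ENNReal.toReal_ofReal hC] at e2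
  rw [← EReal.coe_ennreal_toReal hPt, ← EReal.coe_ennreal_toReal hNt,
    ← EReal.coe_ennreal_toReal hP't, ← EReal.coe_ennreal_toReal hN't]
  norm_cast
  linarith

/-- Transporting `ρ'` to `ρ` by a map `Q` which moves only the points of `G`, by at most `r`,
changes the maximal correlation by at most a multiple of `r`, small if `ρ' G` is small. -/
theorem maxCorr_le_of_map_eq {d : ℕ} {μ ρ ρ' : Measure (Ed d)}
    {Q : Ed d → Ed d} (hQ : Measurable Q) (hmap : ρ'.map Q = ρ) {G : Set (Ed d)}
    (hG : MeasurableSet G) {r : ℝ} (hr : 0 ≤ r) (hin : ∀ x ∈ G, ‖x - Q x‖ ≤ r)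
    (hout : ∀ x ∉ G, Q x = x) {L η m : ℝ} (hL : 0 ≤ L) (hη : 0 ≤ η) (hm : 0 ≤ m)
    (htail : ∫⁻ y in {y | L < ‖y‖}, ‖y‖ₑ ∂μ ≤ ENNReal.ofReal η) (hGm : ρ' G ≤ ENNReal.ofReal m) :
    maxCorr ρ' μ ≤ maxCorr ρ μ + ((2 * (r * (η + L * m)) : ℝ) : EReal) := by
  refine iSup₂_le fun γ hγ => ?_
  obtain ⟨hγp, hγ1, hγ2⟩ := hγ
  have hQm : Measurable fun p : Ed d × Ed d => (Q p.1, p.2) := by fun_prop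
  have hmem : γ.map (fun p => (Q p.1, p.2)) ∈ Couplings ρ μ := by
    refine ⟨Measure.isProbabilityMeasure_map hQm.aemeasurable, ?_, ?_⟩
    · rw [Measure.fst, Measure.map_map measurable_fst hQm, ← hmap, ← hγ1, Measure.fst,
        Measure.map_map hQ measurable_fst]
      rfl
    · rw [Measure.snd, Measure.map_map measurable_snd hQm, ← hγ2, Measure.snd]
      rfl
  refine le_trans ?_ (add_le_add_left (le_iSup₂ (f := fun γ _ => pairInt γ) _ hmem) _)
  let e : Ed d × Ed d → ℝ≥0∞ := fun p =>
    ENNReal.ofReal r * ({y : Ed d | L < ‖y‖}.indicator (fun y => ‖y‖ₑ) p.2 +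
      ENNReal.ofReal L * G.indicator 1 p.1)
  have hLm : MeasurableSet {y : Ed d | L < ‖y‖} := measurableSet_lt measurable_const measurable_norm
  have m1 : Measurable fun p : Ed d × Ed d =>
      {y : Ed d | L < ‖y‖}.indicator (fun y => ‖y‖ₑ) p.2 :=
    (measurable_enorm.indicator hLm).comp measurable_snd
  have m2 : Measurable fun p : Ed d × Ed d => G.indicator (1 : Ed d → ℝ≥0∞) p.1 :=
    (measurable_one.indicator hG).comp measurable_fst
  have hem : Measurable e := (m1.add (m2.const_mul _)).const_mul _
  have hei : ∫⁻ p, e p ∂γ ≤ ENNReal.ofReal (r * (η + L * m)) := by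
    have h1 : ∫⁻ p, {y : Ed d | L < ‖y‖}.indicator (fun y => ‖y‖ₑ) p.2 ∂γ =
        ∫⁻ y in {y | L < ‖y‖}, ‖y‖ₑ ∂μ := by
      rw [← lintegral_indicator hLm, ← hγ2, Measure.snd,
        lintegral_map (measurable_enorm.indicator hLm) measurable_snd]
    have h2 : ∫⁻ p, G.indicator (1 : Ed d → ℝ≥0∞) p.1 ∂γ = ρ' G := by
      rw [← lintegral_indicator_one hG, ← hγ1, Measure.fst,
        lintegral_map (measurable_one.indicator hG) measurable_fst]
    refine (lintegral_const_mul _ (m1.add (m2.const_mul (ENNReal.ofReal L)))).trans_le ?_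
    simp only [Pi.add_apply]
    rw [lintegral_add_left m1,
      lintegral_const_mul _ m2, h1, h2, ENNReal.ofReal_mul hr,
      ENNReal.ofReal_add hη (by positivity), ENNReal.ofReal_mul hL]
    gcongr
  have hpt : ∀ p : Ed d × Ed d, ENNReal.ofReal |(⟪p.1, p.2⟫ : ℝ) - ⟪Q p.1, p.2⟫| ≤ e p := by
    intro p
    rw [← inner_sub_left]
    by_cases hp : p.1 ∈ G
    · have h1 : |(⟪p.1 - Q p.1, p.2⟫ : ℝ)| ≤ r * ‖p.2‖ :=
        (abs_real_inner_le_norm _ _).trans (by gcongr; exact hin _ hp)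
      refine (ENNReal.ofReal_le_ofReal h1).trans ?_
      rw [ENNReal.ofReal_mul hr, ofReal_norm]
      dsimp only [e]
      gcongr
      simp only [Set.indicator_of_mem hp, Pi.one_apply, mul_one]
      by_cases hy : L < ‖p.2‖
      · rw [Set.indicator_of_mem (show p.2 ∈ {y : Ed d | L < ‖y‖} from hy)]
        exact le_self_add
      · rw [← ofReal_norm]
        exact le_add_left (ENNReal.ofReal_le_ofReal (not_lt.1 hy))
    · simp [hout _ hp]
  have hC : 0 ≤ r * (η + L * m) := by positivity
  have hi1 : Measurable fun p : Ed d × Ed d => (⟪p.1, p.2⟫ : ℝ) := by fun_prop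
  rw [pairInt, pairInt, lintegral_map (by fun_prop) hQm, lintegral_map (by fun_prop) hQm]
  refine coe_sub_coe_le_add_two_mul hC ?_ ?_
  · refine le_trans ?_ (add_le_add_right hei _)
    rw [← lintegral_add_right _ hem]
    refine lintegral_mono fun p => ?_
    refine le_trans ?_ (add_le_add_right (hpt p) _)
    refine (ENNReal.ofReal_le_ofReal ?_).trans ENNReal.ofReal_add_le
    linarith [le_abs_self ((⟪p.1, p.2⟫ : ℝ) - ⟪Q p.1, p.2⟫)]
  · refine le_trans ?_ (add_le_add_right hei _)
    rw [← lintegral_add_right _ hem]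
    refine lintegral_mono fun p => ?_
    refine le_trans ?_ (add_le_add_right (hpt p) _)
    refine (ENNReal.ofReal_le_ofReal ?_).trans ENNReal.ofReal_add_le
    linarith [le_abs_self ((⟪p.1, p.2⟫ : ℝ) - ⟪Q p.1, p.2⟫)]

theorem pairInt_eq_integral {d : ℕ} {γ : Measure (Ed d × Ed d)}
    (h : Integrable (fun p : Ed d × Ed d => (⟪p.1, p.2⟫ : ℝ)) γ) :
    pairInt γ = ((∫ p, (⟪p.1, p.2⟫ : ℝ) ∂γ : ℝ) : EReal) := by
  rw [pairInt, integral_eq_lintegral_pos_part_sub_lintegral_neg_part h, EReal.coe_sub,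
    EReal.coe_ennreal_toReal h.lintegral_lt_top.ne,
    EReal.coe_ennreal_toReal (show Integrable (fun p : Ed d × Ed d => -(⟪p.1, p.2⟫ : ℝ)) γ from
      h.neg).lintegral_lt_top.ne]

theorem maxCorr_nonneg {d : ℕ} {ρ μ : Measure (Ed d)} [IsProbabilityMeasure ρ]
    [IsProbabilityMeasure μ] (hρ1 : FirstMoment ρ) (hμ1 : FirstMoment μ) (hμc : Centered μ) :
    0 ≤ maxCorr ρ μ := by
  have hint : Integrable (fun p : Ed d × Ed d => (⟪p.1, p.2⟫ : ℝ)) (ρ.prod μ) :=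
    (Integrable.mul_prod hρ1 hμ1).mono' (by fun_prop)
      (ae_of_all _ fun p => norm_inner_le_norm _ _)
  have hid : Integrable (fun y : Ed d => y) μ :=
    (integrable_norm_iff (by fun_prop)).1 hμ1
  refine le_trans (le_of_eq ?_) (le_iSup₂ (f := fun γ _ => pairInt γ) (ρ.prod μ)
    ⟨inferInstance, Measure.fst_prod, Measure.snd_prod⟩)
  rw [pairInt_eq_integral hint, integral_prod _ hint]
  have : ∀ x : Ed d, ∫ y, (⟪x, y⟫ : ℝ) ∂μ = 0 := fun x => by
    rw [integral_inner hid, show ∫ y, y ∂μ = 0 from hμc, inner_zero_right]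
  simp [this]

/-- The entropy and the maximal correlation with `μ` can be simultaneously less than `⊤`. -/
theorem exists_entropy_add_maxCorr_lt_top {d : ℕ} {μ : Measure (Ed d)} (hμ1 : FirstMoment μ) :
    ∃ ρ : Measure (Ed d), IsProbabilityMeasure ρ ∧ FirstMoment ρ ∧
      entropy ρ + maxCorr ρ μ < ⊤ := by
  set B : Set (Ed d) := Metric.closedBall 0 1 with hB
  have hBm : MeasurableSet B := Metric.isClosed_closedBall.measurableSet
  set V : ℝ := volume.real B with hV
  have hVpos : 0 < V := ENNReal.toReal_pos (Metric.measure_closedBall_pos _ _ one_pos).ne'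
    measure_closedBall_lt_top.ne
  set f : Ed d → ℝ := B.indicator fun _ => V⁻¹ with hfdef
  have hf : Measurable f := measurable_const.indicator hBm
  have hf0 : ∀ x, 0 ≤ f x := Set.indicator_nonneg fun _ _ => by positivity
  set ρ : Measure (Ed d) := volume.withDensity fun x => ENNReal.ofReal (f x) with hρ
  have hρB : ∀ᵐ x ∂ρ, ‖x‖ ≤ 1 := by
    rw [hρ, ae_withDensity_iff hf.ennreal_ofReal]
    refine ae_of_all _ fun x hx => ?_
    by_contra hxB
    refine hx ?_
    rw [hfdef, Set.indicator_of_notMem (by simpa [hB] using hxB), ENNReal.ofReal_zero]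
  have hp : IsProbabilityMeasure ρ := by
    constructor
    rw [hρ, withDensity_apply _ MeasurableSet.univ, Measure.restrict_univ]
    have : ∀ x, ENNReal.ofReal (f x) = B.indicator (fun _ => ENNReal.ofReal V⁻¹) x := by
      intro x
      by_cases hx : x ∈ B <;> simp [hfdef, hx]
    simp_rw [this]
    rw [lintegral_indicator_const hBm, ← ofReal_measureReal measure_closedBall_lt_top.ne,
      ← ENNReal.ofReal_mul (by positivity), ← hV, inv_mul_cancel₀ hVpos.ne', ENNReal.ofReal_one]
  have h1 : FirstMoment ρ := by
    refine Integrable.mono' (integrable_const (1 : ℝ)) (by fun_prop) ?_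
    filter_upwards [hρB] with x hx
    simpa using hx
  refine ⟨ρ, hp, h1, EReal.add_lt_top ?_ ?_⟩
  · rw [entropy_eq_integral_log hf hf0 hρ]
    · exact EReal.coe_ne_top _
    · refine Integrable.mono' (integrable_const |log V⁻¹|) hf.log.aestronglyMeasurable
        (ae_of_all _ fun x => ?_)
      by_cases hx : x ∈ B <;> simp [hfdef, hx]
  · have hle : maxCorr ρ μ ≤ ((∫⁻ y, ‖y‖ₑ ∂μ : ℝ≥0∞) : EReal) := by
      refine iSup₂_le fun γ hγ => ?_
      obtain ⟨-, hγ1, hγ2⟩ := hγ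
      have hx : ∀ᵐ p ∂γ, ‖p.1‖ ≤ 1 := by
        rw [← hγ1, Measure.fst] at hρB
        exact ae_of_ae_map measurable_fst.aemeasurable hρB
      have hpos : ∫⁻ p, ENNReal.ofReal (⟪p.1, p.2⟫ : ℝ) ∂γ ≤ ∫⁻ y, ‖y‖ₑ ∂μ := by
        rw [← hγ2, Measure.snd, lintegral_map measurable_enorm measurable_snd]
        refine lintegral_mono_ae ?_
        filter_upwards [hx] with p hp
        rw [← ofReal_norm]
        refine ENNReal.ofReal_le_ofReal ((real_inner_le_norm _ _).trans ?_)
        exact mul_le_of_le_one_left (norm_nonneg _) hp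
      refine le_trans ?_ (EReal.coe_ennreal_le_coe_ennreal_iff.2 hpos)
      rw [pairInt, sub_eq_add_neg]
      exact add_le_of_nonpos_right (EReal.neg_le_zero.2 (EReal.coe_ennreal_nonneg _))
    have hfin : ∫⁻ y, ‖y‖ₑ ∂μ ≠ ∞ := by
      have : Integrable (fun y : Ed d => ‖y‖) μ := hμ1
      simpa using this.2.ne
    refine ne_of_lt (hle.trans_lt ?_)
    rw [← EReal.coe_ennreal_toReal hfin]
    exact EReal.coe_lt_top _

/-- The measure obtained from `ρ` by moving half of its mass in `S` along the map `D`. -/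
def spread {X : Type*} [MeasurableSpace X] (ρ : Measure X) (S : Set X) (D : X → X) : Measure X :=
  ρ.restrict Sᶜ + (2⁻¹ : ℝ≥0∞) • ρ.restrict S + (2⁻¹ : ℝ≥0∞) • (ρ.restrict S).map D

theorem isProbabilityMeasure_spread {X : Type*} [MeasurableSpace X] {ρ : Measure X}
    [IsProbabilityMeasure ρ] {S : Set X} (hS : MeasurableSet S) {D : X → X} (hD : Measurable D) :
    IsProbabilityMeasure (spread ρ S D) := by
  constructor
  simp only [spread, Measure.add_apply, Measure.smul_apply, smul_eq_mul,
    Measure.map_apply hD MeasurableSet.univ, Set.preimage_univ, Measure.restrict_apply_univ]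
  rw [add_assoc, ← add_mul, ENNReal.inv_two_add_inv_two, one_mul, add_comm,
    measure_add_measure_compl hS, measure_univ]

theorem integrable_spread {X : Type*} [MeasurableSpace X] {ρ : Measure X} {S : Set X} {D : X → X}
    (hD : Measurable D) {g : X → ℝ} (hg : Measurable g) (h1 : IntegrableOn g Sᶜ ρ)
    (h2 : IntegrableOn g S ρ) (h3 : IntegrableOn (fun x => g (D x)) S ρ) :
    Integrable g (spread ρ S D) :=
  ((show Integrable g _ from h1).add_measure (Integrable.smul_measure h2 (by simp))).add_measure
    (((integrable_map_measure hg.aestronglyMeasurable hD.aemeasurable).2 h3).smul_measure (by simp))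

theorem integral_spread {X : Type*} [MeasurableSpace X] {ρ : Measure X} {S : Set X} {D : X → X}
    (hD : Measurable D) {g : X → ℝ} (hg : Measurable g) (h1 : IntegrableOn g Sᶜ ρ)
    (h2 : IntegrableOn g S ρ) (h3 : IntegrableOn (fun x => g (D x)) S ρ) :
    ∫ x, g x ∂(spread ρ S D) =
      ∫ x in Sᶜ, g x ∂ρ + 2⁻¹ * ∫ x in S, g x ∂ρ + 2⁻¹ * ∫ x in S, g (D x) ∂ρ := by
  have h2' : Integrable g ((2⁻¹ : ℝ≥0∞) • ρ.restrict S) := Integrable.smul_measure h2 (by simp)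
  have h3' : Integrable g ((2⁻¹ : ℝ≥0∞) • (ρ.restrict S).map D) :=
    ((integrable_map_measure hg.aestronglyMeasurable hD.aemeasurable).2 h3).smul_measure (by simp)
  rw [spread, integral_add_measure ((show Integrable g _ from h1).add_measure h2') h3',
    integral_add_measure h1 h2', integral_smul_measure, integral_smul_measure,
    integral_map hD.aemeasurable hg.aestronglyMeasurable]
  simp

open Classical in
theorem exists_map_spread_eq {X : Type*} [MeasurableSpace X] {ρ : Measure X} {S : Set X}
    (hS : MeasurableSet S) {D E : X → X} (hD : Measurable D) (hE : Measurable E)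
    (hED : ∀ x, E (D x) = x) (hρ : ∀ᵐ x ∂ρ, E x ∉ S) :
    ∃ Q : X → X, Measurable Q ∧ (spread ρ S D).map Q = ρ ∧ (∀ x, E x ∈ S → Q x = E x) ∧
      ∀ x, E x ∉ S → Q x = x := by
  have hQ : Measurable fun x => if E x ∈ S then E x else x :=
    Measurable.ite (hE hS) hE measurable_id
  have hid : (fun x => if E x ∈ S then E x else x) =ᵐ[ρ] id := by
    filter_upwards [hρ] with x hx
    simp [hx]
  have hidS : (fun x => if E x ∈ S then E x else x) ∘ D =ᵐ[ρ.restrict S] id := by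
    filter_upwards [ae_restrict_mem hS] with x hx
    simp [hED, hx]
  refine ⟨fun x => if E x ∈ S then E x else x, hQ, ?_, fun x hx => if_pos hx,
    fun x hx => if_neg hx⟩
  rw [spread, Measure.map_add _ _ hQ, Measure.map_add _ _ hQ, Measure.map_smul, Measure.map_smul,
    Measure.map_map hQ hD, Measure.map_congr hidS, Measure.map_congr (ae_restrict_of_ae hid),
    Measure.map_congr (ae_restrict_of_ae hid)]
  simp only [Measure.map_id]
  rw [add_assoc, ← add_smul, ENNReal.inv_two_add_inv_two, one_smul, add_comm,
    Measure.restrict_add_restrict_compl hS]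

theorem map_homothety_withDensity {d : ℕ} {a : ℝ} (ha : 0 < a) (p : Ed d) {g : Ed d → ℝ≥0∞}
    (hg : Measurable g) :
    ((volume.withDensity g).map fun x => p + a⁻¹ • (x - p)) =
      volume.withDensity fun x => ENNReal.ofReal (a ^ d) * g (p + a • (x - p)) := by
  have hinv : ∀ x : Ed d, p + a • ((p + a⁻¹ • (x - p)) - p) = x := fun x => by
    rw [add_sub_cancel_left, smul_smul, mul_inv_cancel₀ ha.ne', one_smul, add_sub_cancel]
  have hD : Measurable fun x : Ed d => p + a⁻¹ • (x - p) := by fun_prop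
  have hE : Measurable fun x : Ed d => p + a • (x - p) := by fun_prop
  have hvol : (volume : Measure (Ed d)).map (fun x => p + a⁻¹ • (x - p)) =
      ENNReal.ofReal (a ^ d) • volume := by
    have h1 : (fun x : Ed d => p + a⁻¹ • (x - p)) =
        (fun x => p + x) ∘ (fun x => a⁻¹ • x) ∘ fun x => x - p := rfl
    have h2 : Measurable fun x : Ed d => a⁻¹ • x := by fun_prop
    have h3 : Measurable fun x : Ed d => x - p := by fun_prop
    rw [h1, ← Measure.map_map (measurable_const_add p) (h2.comp h3), ← Measure.map_map h2 h3,
      (measurePreserving_sub_right volume p).map_eq,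
      Measure.map_addHaar_smul _ (inv_ne_zero ha.ne'), Measure.map_smul,
      (measurePreserving_add_left volume p).map_eq]
    congr 2
    rw [finrank_euclideanSpace_fin, inv_pow, inv_inv, abs_of_pos (by positivity)]
  have hgE : Measurable fun x => g (p + a • (x - p)) := hg.comp hE
  ext B hB
  rw [Measure.map_apply hD hB, withDensity_apply _ (hD hB), withDensity_apply _ hB,
    lintegral_const_mul _ hgE]
  calc ∫⁻ x in (fun x => p + a⁻¹ • (x - p)) ⁻¹' B, g x
      = ∫⁻ x in (fun x => p + a⁻¹ • (x - p)) ⁻¹' B, g (p + a • ((p + a⁻¹ • (x - p)) - p)) := by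
        simp_rw [hinv]
    _ = ∫⁻ x in B, g (p + a • (x - p)) ∂(volume.map fun x => p + a⁻¹ • (x - p)) :=
        (setLIntegral_map hB hgE hD).symm
    _ = _ := by rw [hvol, Measure.restrict_smul, lintegral_smul_measure, smul_eq_mul]

/-- Moving half of the mass of a set `S` by a dilation to a place where there is no mass
decreases the entropy by at least `log 2` times the mass of `S`. -/
theorem entropy_spread_le {d : ℕ} {f : Ed d → ℝ} (hf : Measurable f) (hf0 : ∀ x, 0 ≤ f x)
    {ρ : Measure (Ed d)} (hρ : ρ = volume.withDensity fun x => ENNReal.ofReal (f x))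
    [IsProbabilityMeasure ρ] (hint : Integrable (fun x => log (f x)) ρ) {S : Set (Ed d)}
    (hS : MeasurableSet S) (hSpos : ∀ x ∈ S, 0 < f x) {a : ℝ} (ha : 0 < a) (ha1 : a ≤ 1)
    (p : Ed d) (hSD : ∀ x ∈ S, f (p + a⁻¹ • (x - p)) = 0) :
    entropy (spread ρ S fun x => p + a⁻¹ • (x - p)) ≤
      ((∫ x, log (f x) ∂ρ - log 2 * ρ.real S : ℝ) : EReal) := by
  set D : Ed d → Ed d := fun x => p + a⁻¹ • (x - p) with hD
  set E : Ed d → Ed d := fun x => p + a • (x - p) with hE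
  have hDm : Measurable D := by fun_prop
  have hEm : Measurable E := by fun_prop
  have hED : ∀ x, E (D x) = x := fun x => by
    simp only [hD, hE]
    rw [add_sub_cancel_left, smul_smul, mul_inv_cancel₀ ha.ne', one_smul, add_sub_cancel]
  have hDE : ∀ x, D (E x) = x := fun x => by
    simp only [hD, hE]
    rw [add_sub_cancel_left, smul_smul, inv_mul_cancel₀ ha.ne', one_smul, add_sub_cancel]
  set h : Ed d → ℝ := fun x => Sᶜ.indicator f x + 2⁻¹ * S.indicator f x +
    2⁻¹ * (a ^ d * S.indicator f (E x)) with hh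
  have hi : Measurable (S.indicator f) := hf.indicator hS
  have hic : Measurable (Sᶜ.indicator f) := hf.indicator hS.compl
  have hhm : Measurable h :=
    (hic.add (hi.const_mul _)).add (((hi.comp hEm).const_mul _).const_mul _)
  have hi0 : ∀ x, 0 ≤ S.indicator f x := Set.indicator_nonneg fun x _ => hf0 x
  have hic0 : ∀ x, 0 ≤ Sᶜ.indicator f x := Set.indicator_nonneg fun x _ => hf0 x
  have had : 0 < a ^ d := pow_pos ha d
  have hh0 : ∀ x, 0 ≤ h x := fun x => by
    have := hi0 x; have := hic0 x; have := hi0 (E x)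
    positivity
  have hnotS : ∀ x, f x ≠ 0 → E x ∉ S := fun x hx hES => hx (by
    have := hSD _ hES
    rwa [show p + a⁻¹ • (E x - p) = x from hDE x] at this)
  have hhS : ∀ x ∈ S, h x = 2⁻¹ * f x := fun x hx => by
    simp [hh, hx, hnotS x (hSpos x hx).ne']
  have hhSc : ∀ x ∉ S, f x ≠ 0 → h x = f x := fun x hx hfx => by
    simp [hh, hx, hnotS x hfx]
  have hhD : ∀ x ∈ S, h (D x) = 2⁻¹ * (a ^ d * f x) := fun x hx => by
    have h1 : f (D x) = 0 := hSD x hx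
    have h2 : D x ∉ S := fun h => (hSpos _ h).ne' h1
    simp [hh, hED, hx, h2, h1]
  have hspread : spread ρ S D = volume.withDensity fun x => ENNReal.ofReal (h x) := by
    have hind : ∀ T : Set (Ed d), MeasurableSet T → ρ.restrict T =
        volume.withDensity fun x => ENNReal.ofReal (T.indicator f x) := fun T hT => by
      rw [hρ, restrict_withDensity hT, ← withDensity_indicator hT]
      congr 1
      ext x
      by_cases hx : x ∈ T <;> simp [hx]
    have h2 : (2⁻¹ : ℝ≥0∞) = ENNReal.ofReal 2⁻¹ := by
      rw [ENNReal.ofReal_inv_of_pos two_pos]; simp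
    have hiE : Measurable fun x => ENNReal.ofReal (a ^ d) *
        ENNReal.ofReal (S.indicator f (p + a • (x - p))) :=
      (hi.comp hEm).ennreal_ofReal.const_mul _
    rw [spread, hind _ hS, hind _ hS.compl, map_homothety_withDensity ha p hi.ennreal_ofReal,
      ← withDensity_smul _ hi.ennreal_ofReal,
      ← withDensity_smul _ hiE,
      ← withDensity_add_left hic.ennreal_ofReal, ← withDensity_add_left
        (hic.ennreal_ofReal.add (hi.ennreal_ofReal.const_smul _))]
    congr 1
    ext x
    simp only [Pi.add_apply, Pi.smul_apply, smul_eq_mul, hh, h2]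
    have := hi0 x; have := hic0 x; have := hi0 (E x)
    rw [ENNReal.ofReal_add (by positivity) (by positivity),
      ENNReal.ofReal_add (by positivity) (by positivity), ENNReal.ofReal_mul (by positivity),
      ENNReal.ofReal_mul (by positivity), ENNReal.ofReal_mul (by positivity)]
  have hfpos : ∀ᵐ x ∂ρ, f x ≠ 0 := by
    rw [hρ, ae_withDensity_iff hf.ennreal_ofReal]
    refine ae_of_all _ fun x hx hx0 => hx (by rw [hx0, ENNReal.ofReal_zero])
  have e1 : (fun x => log (h x)) =ᵐ[ρ.restrict Sᶜ] fun x => log (f x) := by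
    filter_upwards [ae_restrict_mem hS.compl, ae_restrict_of_ae hfpos] with x hx hx0
    rw [hhSc x hx hx0]
  have e2 : (fun x => log (h x)) =ᵐ[ρ.restrict S] fun x => log (f x) + -log 2 := by
    filter_upwards [ae_restrict_mem hS] with x hx
    rw [hhS x hx, log_mul (by norm_num) (hSpos x hx).ne', log_inv, add_comm]
  have e3 : (fun x => log (h (D x))) =ᵐ[ρ.restrict S]
      fun x => log (f x) + (-log 2 + d * log a) := by
    filter_upwards [ae_restrict_mem hS] with x hx
    rw [hhD x hx, log_mul (by norm_num) (mul_ne_zero had.ne' (hSpos x hx).ne'), log_inv,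
      log_mul had.ne' (hSpos x hx).ne', log_pow]
    ring
  have i0 : ∀ T : Set (Ed d), IntegrableOn (fun x => log (f x)) T ρ := fun T => hint.integrableOn
  have i1 : IntegrableOn (fun x => log (h x)) Sᶜ ρ := (integrable_congr e1).2 (i0 _)
  have i2 : IntegrableOn (fun x => log (h x)) S ρ :=
    (integrable_congr e2).2 ((i0 S).add (integrable_const _))
  have i3 : IntegrableOn (fun x => log (h (D x))) S ρ :=
    (integrable_congr e3).2 ((i0 S).add (integrable_const _))
  rw [entropy_eq_integral_log hhm hh0 hspread (integrable_spread hDm hhm.log i1 i2 i3),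
    integral_spread hDm hhm.log i1 i2 i3, integral_congr_ae e1, integral_congr_ae e2,
    integral_congr_ae e3, integral_add (i0 S) (integrable_const _),
    integral_add (i0 S) (integrable_const _), setIntegral_const, setIntegral_const,
    ← integral_add_compl hS hint, EReal.coe_le_coe_iff]
  simp only [smul_eq_mul]
  have hlog : (d : ℝ) * log a ≤ 0 :=
    mul_nonpos_of_nonneg_of_nonpos (Nat.cast_nonneg d) (log_nonpos ha.le ha1)
  have := mul_nonpos_of_nonneg_of_nonpos (measureReal_nonneg (μ := ρ) (s := S)) hlog
  nlinarith

theorem exists_setLIntegral_enorm_le {d : ℕ} {μ : Measure (Ed d)} (hμ1 : FirstMoment μ) {η : ℝ}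
    (hη : 0 < η) : ∃ L : ℝ, 0 ≤ L ∧ ∫⁻ y in {y | L < ‖y‖}, ‖y‖ₑ ∂μ ≤ ENNReal.ofReal η := by
  have hm : ∀ n : ℕ, MeasurableSet {y : Ed d | (n : ℝ) < ‖y‖} := fun n =>
    measurableSet_lt measurable_const measurable_norm
  have hfin : ∫⁻ y, ‖y‖ₑ ∂μ ≠ ∞ := by
    have : Integrable (fun y : Ed d => ‖y‖) μ := hμ1
    simpa using this.2.ne
  have hfin' : IsFiniteMeasure (μ.withDensity fun y => ‖y‖ₑ) := isFiniteMeasure_withDensity hfin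
  have hlim := tendsto_measure_iInter_atTop (μ := μ.withDensity fun y => ‖y‖ₑ)
    (s := fun n : ℕ => {y : Ed d | (n : ℝ) < ‖y‖}) (fun n => (hm n).nullMeasurableSet)
    (fun m n hmn y hy => show (m : ℝ) < ‖y‖ from
      lt_of_le_of_lt (Nat.cast_le.2 hmn) (show (n : ℝ) < ‖y‖ from hy)) ⟨0, measure_ne_top _ _⟩
  have hempty : ⋂ n : ℕ, {y : Ed d | (n : ℝ) < ‖y‖} = ∅ := by
    refine Set.eq_empty_of_forall_notMem fun y hy => ?_
    obtain ⟨n, hn⟩ := exists_nat_ge ‖y‖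
    exact absurd (Set.mem_iInter.1 hy n) (not_lt.2 hn)
  rw [hempty, measure_empty] at hlim
  obtain ⟨n, hn⟩ := (hlim.eventually (gt_mem_nhds (ENNReal.ofReal_pos.2 hη))).exists
  refine ⟨n, Nat.cast_nonneg n, ?_⟩
  rw [← withDensity_apply _ (hm n)]
  exact hn.le

/-- For a minimizer, the entropy and the maximal correlation are both finite. -/
theorem finite_of_minimizer {d : ℕ} {μ : Measure (Ed d)} [IsProbabilityMeasure μ]
    (hμ1 : FirstMoment μ) (hμc : Centered μ) {f : Ed d → ℝ} (hf : Measurable f)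
    (hf0 : ∀ x, 0 ≤ f x) {ρ : Measure (Ed d)}
    (hρ : ρ = volume.withDensity fun x => ENNReal.ofReal (f x)) [IsProbabilityMeasure ρ]
    (hρ1 : FirstMoment ρ)
    (hmin : ∀ ρ' : Measure (Ed d), IsProbabilityMeasure ρ' → FirstMoment ρ' →
      entropy ρ + maxCorr ρ μ ≤ entropy ρ' + maxCorr ρ' μ) :
    Integrable (fun x => log (f x)) ρ ∧ ∃ t : ℝ, maxCorr ρ μ = t := by
  obtain ⟨ρ₀, hp₀, h₀, hlt⟩ := exists_entropy_add_maxCorr_lt_top hμ1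
  have hfin := (hmin ρ₀ hp₀ h₀).trans_lt hlt
  have hT := maxCorr_nonneg hρ1 hμ1 hμc
  have hTbot : maxCorr ρ μ ≠ ⊥ := fun h => by simp [h] at hT
  have hE : entropy ρ ≠ ⊤ := fun h => by
    rw [h, EReal.top_add_of_ne_bot hTbot] at hfin
    exact lt_irrefl _ hfin
  have hint := integrable_log_of_entropy_ne_top hf hf0 hρ hρ1 hE
  refine ⟨hint, (maxCorr ρ μ).toReal, (EReal.coe_toReal (fun h => ?_) hTbot).symm⟩
  rw [h, entropy_eq_integral_log hf hf0 hρ hint, EReal.coe_add_top] at hfin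
  exact lt_irrefl _ hfin

theorem firstMoment_spread {d : ℕ} {ρ : Measure (Ed d)} [IsProbabilityMeasure ρ]
    (hρ1 : FirstMoment ρ) (S : Set (Ed d)) (b : ℝ) (p : Ed d) :
    FirstMoment (spread ρ S fun x => p + b • (x - p)) := by
  have hid : Integrable (fun y : Ed d => y) ρ := (integrable_norm_iff (by fun_prop)).1 hρ1
  have h : Integrable (fun x => ‖p + b • (x - p)‖) ρ :=
    ((integrable_const p).add ((hid.sub (integrable_const p)).smul b)).norm
  have hρ1' : Integrable (fun x => ‖x‖) ρ := hρ1
  exact integrable_spread (by fun_prop) (by fun_prop) hρ1'.integrableOn hρ1'.integrableOn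
    h.integrableOn

/-- The density of a minimizer, if it vanishes outside a convex set `s`, cannot be bounded below
on the cone over a part `A` of the boundary of `s` unless this cone is Lebesgue-null. -/
theorem volume_cone_eq_zero_of_minimizer {d : ℕ} (hd : 1 ≤ d) {μ : Measure (Ed d)}
    [IsProbabilityMeasure μ] (hμ1 : FirstMoment μ) (hμc : Centered μ) {f : Ed d → ℝ}
    (hf : Measurable f) (hf0 : ∀ x, 0 ≤ f x) {ρ : Measure (Ed d)}
    (hρ : ρ = volume.withDensity fun x => ENNReal.ofReal (f x)) [IsProbabilityMeasure ρ]
    (hρ1 : FirstMoment ρ)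
    (hmin : ∀ ρ' : Measure (Ed d), IsProbabilityMeasure ρ' → FirstMoment ρ' →
      entropy ρ + maxCorr ρ μ ≤ entropy ρ' + maxCorr ρ' μ)
    {s : Set (Ed d)} (hs : Convex ℝ s) (hfs : ∀ x ∉ s, f x = 0) {p : Ed d} (hp : p ∈ interior s)
    {A : Set (Ed d)} (hA : IsCompact A) (hAs : A ⊆ frontier s) {δ : ℝ} (hδ : 0 < δ)
    (hfA : ∀ x ∈ (fun q : ℝ × Ed d => p + q.1 • (q.2 - p)) '' (Set.Icc 0 1 ×ˢ A), δ ≤ f x) :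
    volume ((fun q : ℝ × Ed d => p + q.1 • (q.2 - p)) '' (Set.Icc 0 1 ×ˢ A)) = 0 := by
  obtain ⟨hint, T, hT⟩ := finite_of_minimizer hμ1 hμc hf hf0 hρ hρ1 hmin
  set K : Set (Ed d) := (fun q : ℝ × Ed d => p + q.1 • (q.2 - p)) '' (Set.Icc 0 1 ×ˢ A) with hK
  have hKc : IsCompact K := (isCompact_Icc.prod hA).image (by fun_prop)
  by_contra hvol
  set v : ℝ := volume.real K with hv
  have hvpos : 0 < v := ENNReal.toReal_pos hvol hKc.measure_lt_top.ne
  obtain ⟨R, hRpos, hR⟩ : ∃ R : ℝ, 0 < R ∧ ∀ x ∈ K, ‖x - p‖ ≤ R := by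
    obtain ⟨R, hR⟩ := hKc.isBounded.exists_norm_le
    refine ⟨|R| + ‖p‖ + 1, by positivity, fun x hx => ?_⟩
    linarith [norm_sub_le x p, hR x hx, le_abs_self R]
  have hlog2 : 0 < log 2 := log_pos one_lt_two
  set η : ℝ := log 2 * δ * v / (16 * R) with hη
  have hηpos : 0 < η := by positivity
  obtain ⟨L, hL, htail⟩ := exists_setLIntegral_enorm_le hμ1 hηpos
  obtain ⟨ε, hε, hsmall⟩ := exists_pos_setLIntegral_lt_of_measure_lt
    (μ := (volume : Measure (Ed d))) (f := fun x => ENNReal.ofReal (f x))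
    (by
      have := measure_ne_top ρ Set.univ
      rwa [hρ, withDensity_apply _ MeasurableSet.univ, Measure.restrict_univ] at this)
    (ε := ENNReal.ofReal (η / (L + 1))) (ENNReal.ofReal_pos.2 (by positivity)).ne'
  obtain ⟨a, ha2, ha1, hav⟩ : ∃ a : ℝ, 1 / 2 < a ∧ a < 1 ∧
      ENNReal.ofReal ((1 - a ^ d) * v) < ε := by
    have hlim : Tendsto (fun a : ℝ => ENNReal.ofReal ((1 - a ^ d) * v)) (𝓝[<] 1) (𝓝 0) := by
      have : Continuous fun a : ℝ => ENNReal.ofReal ((1 - a ^ d) * v) :=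
        ENNReal.continuous_ofReal.comp (by fun_prop)
      simpa using (this.tendsto 1).mono_left nhdsWithin_le_nhds
    have h1 : ∀ᶠ a in 𝓝[<] (1 : ℝ), 1 / 2 < a :=
      nhdsWithin_le_nhds (lt_mem_nhds (by norm_num))
    obtain ⟨a, ⟨h1, h2⟩, h3⟩ := ((h1.and self_mem_nhdsWithin).and
      (hlim.eventually (gt_mem_nhds hε))).exists
    exact ⟨a, h1, h2, h3⟩
  have ha0 : 0 < a := by linarith
  set E : Ed d → Ed d := fun x => p + a • (x - p) with hE
  set D : Ed d → Ed d := fun x => p + a⁻¹ • (x - p) with hD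
  have hDm : Measurable D := by fun_prop
  have hEm : Measurable E := by fun_prop
  have hED : ∀ x, E (D x) = x := fun x => by
    simp only [hD, hE]
    rw [add_sub_cancel_left, smul_smul, mul_inv_cancel₀ ha0.ne', one_smul, add_sub_cancel]
  have hDE : ∀ x, D (E x) = x := fun x => by
    simp only [hD, hE]
    rw [add_sub_cancel_left, smul_smul, inv_mul_cancel₀ ha0.ne', one_smul, add_sub_cancel]
  have hEK : MeasurableSet (E '' K) := (hKc.image (by fun_prop)).measurableSet
  have hEKsub : E '' K ⊆ K := by
    rintro _ ⟨_, ⟨⟨t, q⟩, ⟨⟨ht0, ht1⟩, hq⟩, rfl⟩, rfl⟩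
    refine ⟨(a * t, q), ⟨⟨by positivity, ?_⟩, hq⟩, ?_⟩
    · exact mul_le_one₀ ha1.le ht0 ht1
    · simp only [hE, add_sub_cancel_left, smul_smul]
  set S : Set (Ed d) := K \ E '' K with hSdef
  have hSm : MeasurableSet S := hKc.measurableSet.diff hEK
  have hvolE : volume.real (E '' K) = a ^ d * v := by
    have : E = AffineMap.homothety p a := by
      ext1 x
      rw [AffineMap.homothety_apply, vsub_eq_sub, vadd_eq_add, add_comm]
    rw [Measure.real, this, Measure.addHaar_image_homothety, ENNReal.toReal_mul,
      ENNReal.toReal_ofReal (abs_nonneg _), finrank_euclideanSpace_fin,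
      abs_of_pos (by positivity)]
    rfl
  have hvolS : volume.real S = (1 - a ^ d) * v := by
    rw [measureReal_sdiff hEKsub hEK hKc.measure_lt_top.ne, hvolE]; ring
  have hSfin : volume S ≠ ∞ := ne_top_of_le_ne_top hKc.measure_lt_top.ne
    (measure_mono Set.sdiff_subset)
  have hρS : ρ S = ∫⁻ x in S, ENNReal.ofReal (f x) := by rw [hρ, withDensity_apply _ hSm]
  have hSsmall : ρ.real S ≤ η / (L + 1) := by
    refine ENNReal.toReal_le_of_le_ofReal (by positivity) ?_
    rw [hρS]
    refine (hsmall S ?_).le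
    rw [← ofReal_measureReal hSfin, hvolS]
    exact hav
  have hSbig : δ * ((1 - a) * v) ≤ ρ.real S := by
    have h1 : δ * volume.real S ≤ ρ.real S := by
      rw [Measure.real, Measure.real, ← ENNReal.toReal_ofReal hδ.le, ← ENNReal.toReal_mul]
      refine ENNReal.toReal_mono (measure_ne_top _ _) ?_
      rw [hρS, ← setLIntegral_const]
      exact setLIntegral_mono' hSm fun x hx => ENNReal.ofReal_le_ofReal (hfA x hx.1)
    refine le_trans ?_ h1
    rw [hvolS]
    have : a ^ d ≤ a := pow_le_of_le_one ha0.le ha1.le (by omega)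
    gcongr
  have hSD : ∀ x ∈ S, f (D x) = 0 := by
    rintro _ ⟨⟨⟨t, q⟩, ⟨⟨ht0, ht1⟩, hq⟩, rfl⟩, hnot⟩
    have hta : a < t := by
      by_contra! hta
      refine hnot ⟨p + (a⁻¹ * t) • (q - p), ⟨(a⁻¹ * t, q), ⟨⟨by positivity, ?_⟩, hq⟩, rfl⟩, ?_⟩
      · rw [inv_mul_le_iff₀ ha0]; linarith
      · simp only [hE, add_sub_cancel_left, smul_smul]
        rw [mul_inv_cancel_left₀ ha0.ne']
    have htpos : 0 < t := ha0.trans hta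
    refine hfs _ fun hmem => ?_
    have hq' : q ∈ interior s := by
      refine hs.openSegment_interior_self_subset_interior hp hmem ?_
      rw [openSegment_eq_image']
      refine ⟨a / t, ⟨div_pos ha0 htpos, (div_lt_one htpos).2 hta⟩, ?_⟩
      have ht : t ≠ 0 := htpos.ne'
      simp only [hD, add_sub_cancel_left, smul_smul]
      rw [show a / t * (a⁻¹ * t) = 1 by field_simp, one_smul, add_sub_cancel]
    exact (hAs hq).2 hq'
  have hSpos : ∀ x ∈ S, 0 < f x := fun x hx => hδ.trans_le (hfA x hx.1)
  have hfE : ∀ᵐ x ∂ρ, E x ∉ S := by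
    rw [hρ, ae_withDensity_iff hf.ennreal_ofReal]
    refine ae_of_all _ fun x hx hES => hx ?_
    rw [← hDE x, hSD _ hES, ENNReal.ofReal_zero]
  obtain ⟨Q, hQm, hQmap, hQin, hQout⟩ := exists_map_spread_eq hSm hDm hEm hED hfE
  have hGm : spread ρ S D (E ⁻¹' S) ≤ ENNReal.ofReal (ρ.real S) := by
    rw [ofReal_measureReal (measure_ne_top _ _)]
    have h : spread ρ S D (Q ⁻¹' S) = ρ S :=
      (Measure.map_apply hQm hSm).symm.trans (congrArg (fun m => m S) hQmap)
    rw [← h]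
    refine measure_mono fun x hx => ?_
    rw [Set.mem_preimage, hQin x hx]
    exact hx
  have ha' : 0 ≤ a⁻¹ - 1 := by
    have := (one_le_inv₀ ha0).2 ha1.le
    linarith
  have hTle := maxCorr_le_of_map_eq (μ := μ) hQm hQmap (hEm hSm)
    (r := (a⁻¹ - 1) * R) (by positivity) (fun x hx => by
      have hx' : E x ∈ S := hx
      rw [hQin x hx']
      have h1 : x - E x = (a⁻¹ - 1) • (E x - p) := by
        conv_lhs => rw [← hDE x]
        rw [hED]
        simp only [hD, sub_smul, one_smul]
        abel
      rw [h1, norm_smul, Real.norm_of_nonneg ha']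
      gcongr
      exact hR _ hx'.1)
    (fun x hx => hQout x hx) hL hηpos.le measureReal_nonneg htail hGm
  have hEle := entropy_spread_le hf hf0 hρ hint hSm hSpos ha0 ha1.le p hSD
  have hfinal := (hmin _ (isProbabilityMeasure_spread hSm hDm)
    (firstMoment_spread hρ1 S a⁻¹ p)).trans (add_le_add hEle hTle)
  rw [entropy_eq_integral_log hf hf0 hρ hint, hT] at hfinal
  norm_cast at hfinal
  have hLS : L * ρ.real S ≤ η := by
    calc L * ρ.real S ≤ L * (η / (L + 1)) := by gcongr
      _ = η * (L / (L + 1)) := by ring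
      _ ≤ η * 1 := by gcongr; exact (div_le_one (by positivity)).2 (by linarith)
      _ = η := mul_one η
  have hainv : a⁻¹ - 1 ≤ 2 * (1 - a) := by
    have : a⁻¹ - 1 = a⁻¹ * (1 - a) := by field_simp
    rw [this]
    have h2 : a⁻¹ ≤ 2 := by rw [inv_le_comm₀ ha0 two_pos]; linarith
    gcongr
  have hloss : 2 * ((a⁻¹ - 1) * R * (η + L * ρ.real S)) ≤ log 2 * (δ * ((1 - a) * v)) / 2 := by
    calc 2 * ((a⁻¹ - 1) * R * (η + L * ρ.real S))
        ≤ 2 * ((2 * (1 - a)) * R * (η + η)) := by gcongr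
      _ = log 2 * (δ * ((1 - a) * v)) / 2 := by rw [hη]; field_simp; ring
  have hgain : log 2 * (δ * ((1 - a) * v)) ≤ log 2 * ρ.real S := by gcongr
  have hpos : 0 < log 2 * (δ * ((1 - a) * v)) := by
    have : 0 < 1 - a := by linarith
    positivity
  linarith

theorem measurable_expNegE : Measurable expNegE := by
  unfold expNegE
  exact Measurable.ite (measurableSet_singleton ⊤) measurable_const
    (measurable_exp.comp (by fun_prop))

theorem expNegE_nonneg (t : EReal) : 0 ≤ expNegE t := by
  unfold expNegE
  split_ifs <;> positivity

theorem exp_neg_le_expNegE {t : EReal} (ht : t ≠ ⊥) {M : ℝ} (h : t ≤ M) :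
    exp (-M) ≤ expNegE t := by
  have htop : t ≠ ⊤ := (h.trans_lt (EReal.coe_lt_top M)).ne
  rw [expNegE, if_neg htop]
  lift t to ℝ using ⟨htop, ht⟩
  rw [EReal.toReal_coe]
  gcongr
  exact_mod_cast h

theorem EConvexOn.combo_le_coe {d : ℕ} {u : Ed d → EReal} (hu : EConvexOn u)
    (hubot : ∀ x, u x ≠ ⊥) {x y : Ed d} {M : ℝ} (hx : u x ≤ M) (hy : u y ≤ M) {a b : ℝ}
    (ha : 0 ≤ a) (hb : 0 ≤ b) (hab : a + b = 1) : u (a • x + b • y) ≤ M := by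
  refine (hu x y a b ha hb hab).trans ?_
  have hxt : u x ≠ ⊤ := (hx.trans_lt (EReal.coe_lt_top M)).ne
  have hyt : u y ≠ ⊤ := (hy.trans_lt (EReal.coe_lt_top M)).ne
  lift u x to ℝ using ⟨hxt, hubot x⟩ with r
  lift u y to ℝ using ⟨hyt, hubot y⟩ with r'
  norm_cast at hx hy ⊢
  have h1 := mul_le_mul_of_nonneg_left hx ha
  have h2 := mul_le_mul_of_nonneg_left hy hb
  have h3 : a * M + b * M = M := by rw [← add_mul, hab, one_mul]
  linarith

theorem EConvexOn.convex_lt_top {d : ℕ} {u : Ed d → EReal} (hu : EConvexOn u)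
    (hubot : ∀ x, u x ≠ ⊥) : Convex ℝ {x | u x < ⊤} := by
  intro x hx y hy a b ha hb hab
  obtain ⟨M, hM⟩ := EReal.lt_iff_exists_real_btwn.1 hx
  obtain ⟨N, hN⟩ := EReal.lt_iff_exists_real_btwn.1 hy
  refine (hu.combo_le_coe hubot (M := max M N) (hM.1.le.trans ?_) (hN.1.le.trans ?_)
    ha hb hab).trans_lt (EReal.coe_lt_top _)
  · exact_mod_cast le_max_left M N
  · exact_mod_cast le_max_right M N

/-- if `ρ = c e^{-u} dx` is a probability measure minimizing `E(·) + T(·,μ)`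
over `P_1`, then `u` is essentially continuous: its density vanishes `H^{d-1}`-a.e. on the
boundary of `{u < +∞}`. -/
theorem minimizer_essentially_continuous {d : ℕ} (hd : 1 ≤ d)
    (μ : Measure (Ed d)) [IsProbabilityMeasure μ] (hμ1 : FirstMoment μ) (hμc : Centered μ)
    (hμH : ¬ ∃ e : Ed d, ∃ ℓ : ℝ, ‖e‖ = 1 ∧ μ {y | (⟪y, e⟫ : ℝ) = ℓ} = 1)
    (u : Ed d → EReal) (hubot : ∀ x, u x ≠ ⊥) (huconv : EConvexOn u)
    (hulsc : LowerSemicontinuous u) (huproper : ∃ x, u x ≠ ⊤)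
    (c : ℝ) (hc : 0 < c)
    (ρ : Measure (Ed d))
    (hρ : ρ = volume.withDensity (fun x => ENNReal.ofReal (c * expNegE (u x))))
    (hρprob : IsProbabilityMeasure ρ) (hρ1 : FirstMoment ρ)
    (hmin : ∀ ρ'' : Measure (Ed d), IsProbabilityMeasure ρ'' → FirstMoment ρ'' →
      entropy ρ + maxCorr ρ μ ≤ entropy ρ'' + maxCorr ρ'' μ) :
    μH[(d : ℝ) - 1] {x : Ed d | x ∈ frontier {y | u y < ⊤} ∧ u x < ⊤} = 0 := by
  set s : Set (Ed d) := {y | u y < ⊤} with hs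
  have hconv : Convex ℝ s := huconv.convex_lt_top hubot
  set f : Ed d → ℝ := fun x => c * expNegE (u x) with hf
  have hfm : Measurable f := (measurable_expNegE.comp hulsc.measurable).const_mul c
  have hf0 : ∀ x, 0 ≤ f x := fun x => mul_nonneg hc.le (expNegE_nonneg _)
  have hfs : ∀ x ∉ s, f x = 0 := fun x hx => by
    have : u x = ⊤ := not_lt_top_iff.1 hx
    simp [hf, expNegE, this]
  obtain ⟨p, hp⟩ : (interior s).Nonempty := by
    by_contra hempty
    rw [Set.not_nonempty_iff_eq_empty] at hempty
    have hs0 : volume s = 0 := by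
      refine measure_mono_null subset_closure ?_
      rw [closure_eq_interior_union_frontier, hempty, Set.empty_union]
      exact hconv.addHaar_frontier volume
    have huniv : ρ Set.univ = 0 := by
      rw [hρ, withDensity_apply _ MeasurableSet.univ, Measure.restrict_univ,
        lintegral_eq_zero_iff hfm.ennreal_ofReal]
      filter_upwards [measure_eq_zero_iff_ae_notMem.1 hs0] with x hx
      simp only [Pi.zero_apply]
      rw [hfs x hx, ENNReal.ofReal_zero]
    simp at huniv
  have hps : p ∈ s := interior_subset hp
  have hpt : u p < ⊤ := hps
  let A : ℕ → Set (Ed d) := fun n =>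
    frontier s ∩ (u ⁻¹' Set.Iic ((n : ℝ) : EReal) ∩ Metric.closedBall 0 n)
  have hAc : ∀ n, IsCompact (A n) := fun n => by
    rw [show A n = (frontier s ∩ u ⁻¹' Set.Iic ((n : ℝ) : EReal)) ∩ Metric.closedBall 0 n from
      (Set.inter_assoc _ _ _).symm]
    exact (isCompact_closedBall 0 (n : ℝ)).inter_left
      (isClosed_frontier.inter (hulsc.isClosed_preimage _))
  have hA0 : ∀ n, μH[(d : ℝ) - 1] (A n) = 0 := by
    intro n
    obtain ⟨N, hN⟩ := EReal.lt_iff_exists_real_btwn.1 hpt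
    refine hconv.hausdorffMeasure_eq_zero_of_cone_null hd hp Set.inter_subset_left
      (volume_cone_eq_zero_of_minimizer hd hμ1 hμc hfm hf0 hρ hρ1 hmin hconv hfs hp (hAc n)
        Set.inter_subset_left (δ := c * exp (-max N n)) (by positivity) ?_)
    rintro _ ⟨⟨t, q⟩, ⟨⟨ht0, ht1⟩, hq⟩, rfl⟩
    refine mul_le_mul_of_nonneg_left (exp_neg_le_expNegE (hubot _) ?_) hc.le
    have hle := huconv.combo_le_coe hubot (x := p) (y := q) (M := max N n) (a := 1 - t) (b := t)
      (hN.1.le.trans (by exact_mod_cast le_max_left N n))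
      (le_trans hq.2.1 (by exact_mod_cast le_max_right N (n : ℝ)))
      (by linarith) ht0 (by ring)
    convert hle using 2
    simp only [smul_sub, sub_smul, one_smul]
    abel
  refine measure_mono_null (fun x hx => ?_) (measure_iUnion_null hA0)
  obtain ⟨M, hM⟩ := EReal.lt_iff_exists_real_btwn.1 hx.2
  obtain ⟨n, hn⟩ := exists_nat_ge (max M ‖x‖)
  refine Set.mem_iUnion.2 ⟨n, hx.1, ?_, ?_⟩
  · refine hM.1.le.trans ?_
    exact_mod_cast (le_max_left _ _).trans hn
  · simpa using (le_max_right _ _).trans hn
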